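/- Let X = (X_u)_{u∈V_2} be an allocation to V_2 with n ≥ 2, and let i ∈ V_1 be an agent such that (i, r) is not an edge of G_X. Suppose there is no pair (u*, g) with u* ∈ V_2 and g ∈ X_{u*} such that (i, u*) is an edge of G_X, |X_{u*}| ≥ 2, and (i, u*) remains an edge of the PROPavg-graph of the allocation obtained from X by moving g to X_r. Then for every u ∈ V_2 such that (i, u) is an edge of G_X: v_i(X_u) − m_i(X_u) + (1/(n−1)) ∑_{u'∈V_2∖{r,u} : (i,u') is an edge of G_X} m_i(X_{u'}) < 1/n. -/

import Mathlib

open Finset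
open scoped Classical

noncomputable section

variable {G : Type*}

/-- Value of a bundle under an additive valuation. -/
def val (v : G → ℝ) (S : Finset G) : ℝ := ∑ g ∈ S, v g

/-- Minimum value of a good in a bundle; `0` for the empty bundle. -/
def minval (v : G → ℝ) (S : Finset G) : ℝ :=
  if h : S.Nonempty then S.inf' h v else 0

/-- `X` is a partition of the goods into `n` pairwise disjoint (possibly empty) bundles. -/
def IsAlloc {n : ℕ} (X : Fin n → Finset G) : Prop :=
  (∀ i j : Fin n, i ≠ j → Disjoint (X i) (X j)) ∧ (∀ g : G, ∃ i : Fin n, g ∈ X i)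

/-- Agent `i` is PROPavg-satisfied by the allocation `X`. -/
def PROPavgSat {n : ℕ} (v : Fin n → G → ℝ) (X : Fin n → Finset G) (i : Fin n) : Prop :=
  val (v i) (X i) + (1 / ((n : ℝ) - 1)) * ∑ k ∈ Finset.univ.erase i, minval (v i) (X k)
    ≥ 1 / (n : ℝ)

/-- Edge of the PROPavg-graph between agent `i ∈ V₁` and label `u ∈ V₂` (both parts
are indexed by `Fin n`, `r` is the distinguished element of `V₂`). -/
def Edge {n : ℕ} (v : Fin n → G → ℝ) (X : Fin n → Finset G) (r i u : Fin n) : Prop :=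
  val (v i) (X u) + (1 / ((n : ℝ) - 1)) *
      ∑ u' ∈ (Finset.univ.erase r).erase u, minval (v i) (X u')
    ≥ 1 / (n : ℝ)

/-- `i` is one of the agents `1, …, n-1`, i.e. not the last agent. -/
def InV1 {n : ℕ} (i : Fin n) : Prop := (i : ℕ) < n - 1

/-- The set `V₁` of the first `n-1` agents. -/
def V1 (n : ℕ) : Finset (Fin n) := Finset.univ.filter fun i => (i : ℕ) < n - 1

/-- A perfect matching of `V₁` onto `V₂ \ {u}` in the PROPavg-graph `G_X`,
i.e. a bijection from `V₁` to `V₂ \ {u}` all of whose pairs are edges. -/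
def IsPM {n : ℕ} (v : Fin n → G → ℝ) (X : Fin n → Finset G) (r u : Fin n)
    (f : Fin n → Fin n) : Prop :=
  Set.InjOn f {i : Fin n | InV1 i} ∧
  (∀ i : Fin n, InV1 i → f i ≠ u ∧ Edge v X r i (f i)) ∧
  (∀ w : Fin n, w ≠ u → ∃ i : Fin n, InV1 i ∧ f i = w)

/-- Property (P1): `G_X - r` has a perfect matching. -/
def P1 {n : ℕ} (v : Fin n → G → ℝ) (X : Fin n → Finset G) (r : Fin n) : Prop :=
  ∃ f : Fin n → Fin n, IsPM v X r r f

/-- Property (P2): for every `u ∈ V₂`, `G_X - u` has a perfect matching. -/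
def P2 {n : ℕ} (v : Fin n → G → ℝ) (X : Fin n → Finset G) (r : Fin n) : Prop :=
  ∀ u : Fin n, ∃ f : Fin n → Fin n, IsPM v X r u f

/-- The neighborhood `Γ_{G_X}(S) ⊆ V₂` of a set `S ⊆ V₁` in the PROPavg-graph. -/
def Nbr {n : ℕ} (v : Fin n → G → ℝ) (X : Fin n → Finset G) (r : Fin n)
    (S : Finset (Fin n)) : Finset (Fin n) :=
  Finset.univ.filter fun u => ∃ i ∈ S, Edge v X r i u

/-- The allocation obtained from `X` by moving the good `g ∈ X ustar` to `X r`. -/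
def move {n : ℕ} [DecidableEq G] (X : Fin n → Finset G) (r ustar : Fin n) (g : G) :
    Fin n → Finset G :=
  fun u => if u = r then insert g (X r) else if u = ustar then (X ustar).erase g else X u

theorem minval_nonneg {v : G → ℝ} (hv : ∀ g, 0 ≤ v g) (S : Finset G) : 0 ≤ minval v S := by
  unfold minval
  split_ifs with h
  · exact (Finset.le_inf'_iff h v).2 fun g _ => hv g
  · exact le_rfl

theorem exists_mem_eq_minval (v : G → ℝ) {S : Finset G} (hS : S.Nonempty) :
    ∃ g ∈ S, v g = minval v S := by
  obtain ⟨g, hg, h⟩ := Finset.exists_mem_eq_inf' hS v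
  exact ⟨g, hg, by rw [minval, dif_pos hS, h]⟩

/-- In a bundle with at most one good, removing the least valued good leaves nothing. -/
theorem val_sub_minval_of_card_le_one (v : G → ℝ) {S : Finset G} (hS : S.card ≤ 1) :
    val v S - minval v S = 0 := by
  rcases S.eq_empty_or_nonempty with rfl | hne
  · simp [_root_.val, minval]
  · obtain ⟨g, rfl⟩ := Finset.card_eq_one.1 (le_antisymm hS hne.card_pos)
    simp [_root_.val, minval]

/-- Moving `g` from `X u` to `X r` lowers the value of the bundle `u` by `v i g` and leaves the
bundles averaged over in the edge condition unchanged. -/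
theorem edge_move_iff [DecidableEq G] {n : ℕ} (v : Fin n → G → ℝ) (X : Fin n → Finset G)
    {r i u : Fin n} (hur : u ≠ r) {g : G} (hg : g ∈ X u) :
    Edge v (move X r u g) r i u ↔
      val (v i) (X u) - v i g + (1 / ((n : ℝ) - 1)) *
        ∑ u' ∈ (Finset.univ.erase r).erase u, minval (v i) (X u') ≥ 1 / (n : ℝ) := by
  have hval : val (v i) (move X r u g u) = val (v i) (X u) - v i g := by
    simp only [move, if_neg hur, if_true, _root_.val]
    rw [← Finset.sum_erase_add _ _ hg, add_sub_cancel_right]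
  have hsum : ∑ u' ∈ (Finset.univ.erase r).erase u, minval (v i) (move X r u g u') =
      ∑ u' ∈ (Finset.univ.erase r).erase u, minval (v i) (X u') := by
    refine Finset.sum_congr rfl fun w hw => ?_
    obtain ⟨hwu, hw⟩ := Finset.mem_erase.1 hw
    simp only [move, if_neg (Finset.ne_of_mem_erase hw), if_neg hwu]
  rw [Edge, hval, hsum]

/-- Claim 1 in Lemma 5: if no good can be moved to `X r` keeping an
edge at `i`, then the stated strict inequality holds for every edge `(i, u)`. -/
theorem no_removable_good_ineq {G : Type*} [Fintype G] [DecidableEq G] (n : ℕ) (hn : 2 ≤ n)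
    (v : Fin n → G → ℝ) (X : Fin n → Finset G) (r : Fin n)
    (hpos : ∀ (i : Fin n) (g : G), 0 ≤ v i g)
    (hnorm : ∀ i : Fin n, val (v i) (Finset.univ : Finset G) = 1)
    (hX : IsAlloc X)
    (i : Fin n) (hi : InV1 i) (hir : ¬ Edge v X r i r)
    (hno : ¬ ∃ (ustar : Fin n) (g : G), ustar ≠ r ∧ g ∈ X ustar ∧ Edge v X r i ustar ∧
      2 ≤ (X ustar).card ∧ Edge v (move X r ustar g) r i ustar) :
    ∀ u : Fin n, Edge v X r i u →
      val (v i) (X u) - minval (v i) (X u) +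
        (1 / ((n : ℝ) - 1)) *
          ∑ u' ∈ ((Finset.univ.erase r).erase u).filter (fun u' => Edge v X r i u'),
            minval (v i) (X u')
        < 1 / (n : ℝ) := by
  intro u hu
  have hur : u ≠ r := fun h => hir (h ▸ hu)
  have hc : 0 ≤ 1 / ((n : ℝ) - 1) := by
    have : (2 : ℝ) ≤ n := by exact_mod_cast hn
    exact one_div_nonneg.2 (by linarith)
  have hm : ∀ w, 0 ≤ minval (v i) (X w) := fun w => minval_nonneg (hpos i) (X w)
  have hfilter := mul_le_mul_of_nonneg_left (Finset.sum_le_sum_of_subset_of_nonneg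
    (Finset.filter_subset (fun u' => Edge v X r i u') ((Finset.univ.erase r).erase u))
    fun w _ _ => hm w) hc
  rcases Nat.lt_or_ge (X u).card 2 with hcard | hcard
  · rw [val_sub_minval_of_card_le_one (v i) (Nat.le_of_lt_succ hcard)]
    have herase := mul_le_mul_of_nonneg_left (Finset.sum_le_sum_of_subset_of_nonneg
      (Finset.erase_subset u (Finset.univ.erase r)) fun w _ _ => hm w) hc
    have hr : 0 ≤ val (v i) (X r) := Finset.sum_nonneg fun g _ => hpos i g
    rw [Edge, Finset.erase_idem, not_le] at hir
    linarith
  · obtain ⟨g, hg, hgmin⟩ :=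
      exists_mem_eq_minval (v i) (Finset.card_pos.1 (Nat.zero_lt_two.trans_le hcard))
    have hmove : ¬ Edge v (move X r u g) r i u := fun h => hno ⟨u, g, hur, hg, hu, hcard, h⟩
    rw [edge_move_iff v X hur hg, hgmin, not_le] at hmove
    linarith
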